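/- arXiv:2106.12936 — 2 statements merged into one kernel-verified Lean document; each statement's English description precedes it below -/
import Mathlib

section
/- Grant the compatibility condition ζ ≤ √(2⌊K/2⌋)/(4K) and assume K>2. There exist constants c=c(K)>0 and ε₀>0 such that whenever ε≤ε₀, δ≤1/6, L≤1/3 and n·δ²·ε²·ζ⁴ ≥ 1: the infimum over all estimators ψ̂₂ (measurable functions of (Y₁,…,Yₙ) with values in ℝ^K) of sup over (φ,ψ)∈Φ_L(δ,ε,ζ) of P_{(φ,ψ)}( min(‖ψ̂₂−ψ₂‖, ‖ψ̂₂+ψ₂‖)² ≥ c/(n·δ²·ε²·ζ⁴) ) is at least 1/4. -/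
open scoped BigOperators

namespace PaperHMM

/-- Parameter of a two-state HMM with multinomial emissions on `Fin K`. -/
structure Param (K : ℕ) where
  p : ℝ
  q : ℝ
  f0 : Fin K → ℝ
  f1 : Fin K → ℝ

/-- `f` is a probability density with respect to counting measure on `Fin K`. -/
def IsDensity {K : ℕ} (f : Fin K → ℝ) : Prop :=
  (∀ k, 0 ≤ f k) ∧ ∑ k, f k = 1

/-- Validity of HMM parameters: `p, q ∈ (0,1)` and emission densities. -/
def Valid {K : ℕ} (θ : Param K) : Prop :=
  θ.p ∈ Set.Ioo (0 : ℝ) 1 ∧ θ.q ∈ Set.Ioo (0 : ℝ) 1 ∧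
    IsDensity θ.f0 ∧ IsDensity θ.f1

/-- Euclidean norm of a finitely supported real function. -/
noncomputable def enormF {α : Type*} [Fintype α] (g : α → ℝ) : ℝ :=
  Real.sqrt (∑ a, (g a) ^ 2)

/-- Stationary initial distribution of the hidden chain: `P(X₁=0)=q/(p+q)`. -/
noncomputable def initD {K : ℕ} (θ : Param K) : Fin 2 → ℝ :=
  fun a => if a = 0 then θ.q / (θ.p + θ.q) else θ.p / (θ.p + θ.q)

/-- Transition matrix `Q = [[1-p, p], [q, 1-q]]` of the hidden chain. -/
noncomputable def transP {K : ℕ} (θ : Param K) : Fin 2 → Fin 2 → ℝ :=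
  fun a b =>
    if a = 0 then (if b = 0 then 1 - θ.p else θ.p)
    else (if b = 0 then θ.q else 1 - θ.q)

/-- Emission densities indexed by the hidden state. -/
def emit {K : ℕ} (θ : Param K) : Fin 2 → Fin K → ℝ :=
  fun a => if a = 0 then θ.f0 else θ.f1

/-- The probability mass function `p_θ^{(n)}` of the first `n` observations
`(Y₁,…,Yₙ)`:  `∑_{x ∈ {0,1}ⁿ} P(X₁=x₁) ∏_{i<n} Q_{x_i,x_{i+1}} ∏_{i≤n} f_{x_i}(y_i)`. -/
noncomputable def pLaw {K : ℕ} (θ : Param K) (n : ℕ) (y : Fin n → Fin K) : ℝ :=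
  ∑ x : Fin n → Fin 2,
    (∏ i : Fin n,
        (if (i : ℕ) = 0 then initD θ (x i)
          else transP θ (x ⟨(i : ℕ) - 1, lt_of_le_of_lt (Nat.sub_le _ _) i.isLt⟩) (x i)))
      * ∏ i : Fin n, emit θ (x i) (y i)

open Classical in
/-- Probability under `P_θ` that `(Y₁,…,Yₙ)` lies in the event `E`. -/
noncomputable def probOf {K : ℕ} (θ : Param K) (n : ℕ)
    (E : (Fin n → Fin K) → Prop) : ℝ :=
  ∑ y : Fin n → Fin K, if E y then pLaw θ n y else 0

/-- The parameter class `Θ(δ,ε,ζ)`. -/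
def ThetaSet (K : ℕ) (δ ε ζ : ℝ) : Set (Param K) :=
  {θ | Valid θ ∧ δ ≤ θ.p ∧ δ ≤ θ.q ∧ ε ≤ |1 - θ.p - θ.q| ∧
    ζ ≤ enormF (fun k => θ.f0 k - θ.f1 k)}

/-- The parameter class `Θ_L(δ,ε,ζ)`. -/
def ThetaL (K : ℕ) (L δ ε ζ : ℝ) : Set (Param K) :=
  ThetaSet K δ ε ζ ∩ {θ | L ≤ 1 - |1 - θ.p - θ.q|}

/-- The reparametrised pair `(φ, ψ)`: scalar parameters `φ = (φ₁,φ₂,φ₃)` and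
vector parameters `ψ = (ψ₁, ψ₂)`. -/
abbrev PP (K : ℕ) := (ℝ × ℝ × ℝ) × ((Fin K → ℝ) × (Fin K → ℝ))

/-- `φ(θ) = ((q-p)/(p+q), 1-p-q, ‖f₀-f₁‖)`. -/
noncomputable def phiOf {K : ℕ} (θ : Param K) : ℝ × ℝ × ℝ :=
  ((θ.q - θ.p) / (θ.p + θ.q), 1 - θ.p - θ.q,
    enormF (fun k => θ.f0 k - θ.f1 k))

/-- `ψ(θ) = ((q f₀ + p f₁)/(p+q), (f₀-f₁)/‖f₀-f₁‖)`. -/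
noncomputable def psiOf {K : ℕ} (θ : Param K) : (Fin K → ℝ) × (Fin K → ℝ) :=
  (fun k => (θ.q * θ.f0 k + θ.p * θ.f1 k) / (θ.p + θ.q),
    fun k => (θ.f0 k - θ.f1 k) / enormF (fun j => θ.f0 j - θ.f1 j))

/-- The map `θ ↦ (φ(θ), ψ(θ))`. -/
noncomputable def pack {K : ℕ} (θ : Param K) : PP K := (phiOf θ, psiOf θ)

/-- The inverse parametrisation `θ(φ,ψ)`:
`p = ½(1-φ₂)(1-φ₁)`, `q = ½(1-φ₂)(1+φ₁)`,
`f₀ = ψ₁ - ½φ₁φ₃ψ₂ + ½φ₃ψ₂`, `f₁ = ψ₁ - ½φ₁φ₃ψ₂ - ½φ₃ψ₂`. -/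
noncomputable def unpack {K : ℕ} (π : PP K) : Param K where
  p := (1 - π.1.2.1) * (1 - π.1.1) / 2
  q := (1 - π.1.2.1) * (1 + π.1.1) / 2
  f0 := fun k => π.2.1 k - π.1.1 * π.1.2.2 * π.2.2 k / 2 + π.1.2.2 * π.2.2 k / 2
  f1 := fun k => π.2.1 k - π.1.1 * π.1.2.2 * π.2.2 k / 2 - π.1.2.2 * π.2.2 k / 2

/-- `Φ(δ,ε,ζ)`. -/
def PhiSet (K : ℕ) (δ ε ζ : ℝ) : Set (PP K) := pack '' ThetaSet K δ ε ζ

/-- `Φ_L(δ,ε,ζ)`. -/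
def PhiL (K : ℕ) (L δ ε ζ : ℝ) : Set (PP K) := pack '' ThetaL K L δ ε ζ

/-- `⋃_{δ,ε,ζ} Φ(δ,ε,ζ)`. -/
def PhiAll (K : ℕ) : Set (PP K) :=
  ⋃ (δ ∈ Set.Ioo (0 : ℝ) 1) (ε ∈ Set.Ioo (0 : ℝ) 1) (ζ ∈ Set.Ioi (0 : ℝ)),
    PhiSet K δ ε ζ

/-- `r(φ) = ¼ (1-φ₁²) φ₂ φ₃²`. -/
noncomputable def rfun (φ : ℝ × ℝ × ℝ) : ℝ :=
  (1 - φ.1 ^ 2) * φ.2.1 * φ.2.2 ^ 2 / 4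

/-- `m(φ) = (r(φ), φ₂ r(φ), φ₁ φ₂ φ₃ r(φ))`. -/
noncomputable def mvec (φ : ℝ × ℝ × ℝ) : ℝ × ℝ × ℝ :=
  (rfun φ, φ.2.1 * rfun φ, φ.1 * φ.2.1 * φ.2.2 * rfun φ)

/-- Sign function with the convention `sgn 0 = +1`. -/
noncomputable def sgn (t : ℝ) : ℝ := if t < 0 then -1 else 1

/-- The statistical distance `ρ((φ,ψ);(φ̃,ψ̃))`. -/
noncomputable def rho {K : ℕ} (π π' : PP K) : ℝ :=
  max (max (max (max
    |(mvec π.1).1 - (mvec π'.1).1|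
    |(mvec π.1).2.1 - (mvec π'.1).2.1|)
    |(mvec π.1).2.2 - sgn (∑ k, π.2.2 k * π'.2.2 k) * (mvec π'.1).2.2|)
    (enormF fun k => π.2.1 k - π'.2.1 k))
    ((max |(mvec π.1).1| |(mvec π'.1).1|) *
      enormF fun k => π.2.2 k - sgn (∑ j, π.2.2 j * π'.2.2 j) * π'.2.2 k)

/-- `p^{(3)}_{φ,ψ} = p^{(3)}_{θ(φ,ψ)}`, the law of three consecutive observations. -/
noncomputable def p3 {K : ℕ} (π : PP K) : (Fin 3 → Fin K) → ℝ :=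
  pLaw (unpack π) 3

/-- The empirical estimator `p̂ₙ^{(3)}(a,b,c) = n⁻¹ ∑_{i=1}^{n-2} 1{Yᵢ=a, Y_{i+1}=b, Y_{i+2}=c}`. -/
noncomputable def empP3 {K : ℕ} (n : ℕ) (y : Fin n → Fin K)
    (v : Fin 3 → Fin K) : ℝ :=
  (n : ℝ)⁻¹ * ∑ i : Fin n,
    if h : (i : ℕ) + 2 < n then
      (if y i = v 0 ∧ y ⟨(i : ℕ) + 1, by omega⟩ = v 1 ∧ y ⟨(i : ℕ) + 2, h⟩ = v 2
        then 1 else 0)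
    else 0

/-- Kullback–Leibler divergence `K(P;Q) = ∑_y P(y) log(P(y)/Q(y))` between
probability mass functions on `(Fin K)ⁿ`. -/
noncomputable def klDiv {K : ℕ} (n : ℕ) (P Q : (Fin n → Fin K) → ℝ) : ℝ :=
  ∑ y : Fin n → Fin K, P y * Real.log (P y / Q y)


/-! ### Forward recursion for the law -/

/-- Weight of the next hidden state given the path so far. -/
noncomputable def nextW {K : ℕ} (θ : Param K) (n : ℕ) (x : Fin n → Fin 2) (b : Fin 2) : ℝ :=
  if h : n = 0 then initD θ b else transP θ (x ⟨n - 1, by omega⟩) b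

/-- Weight of the hidden path together with observations. -/
noncomputable def pathW {K : ℕ} (θ : Param K) (n : ℕ) (y : Fin n → Fin K)
    (x : Fin n → Fin 2) : ℝ :=
  (∏ i : Fin n,
        (if (i : ℕ) = 0 then initD θ (x i)
          else transP θ (x ⟨(i : ℕ) - 1, lt_of_le_of_lt (Nat.sub_le _ _) i.isLt⟩) (x i)))
      * ∏ i : Fin n, emit θ (x i) (y i)

/-- Joint mass of the first `n` observations and the next hidden state. -/
noncomputable def fwd {K : ℕ} (θ : Param K) : (n : ℕ) → (Fin n → Fin K) → Fin 2 → ℝ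
  | 0, _, b => initD θ b
  | (n + 1), y, b =>
      ∑ a, fwd θ n (fun i => y i.castSucc) a * emit θ a (y (Fin.last n)) * transP θ a b

lemma pathW_snoc {K : ℕ} (θ : Param K) (n : ℕ) (y : Fin (n + 1) → Fin K)
    (x : Fin n → Fin 2) (a : Fin 2) :
    pathW θ (n + 1) y (Fin.snoc (α := fun _ => Fin 2) x a)
      = pathW θ n (fun i => y i.castSucc) x * nextW θ n x a * emit θ a (y (Fin.last n)) := by
  unfold pathW nextW
  rw [Fin.prod_univ_castSucc, Fin.prod_univ_castSucc]
  simp only [Fin.snoc_castSucc, Fin.snoc_last, Fin.val_castSucc, Fin.val_last]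
  have h1 : ∀ i : Fin n, (Fin.snoc (α := fun _ => Fin 2) x a : Fin (n + 1) → Fin 2)
      ⟨(i : ℕ) - 1, by omega⟩ = x ⟨(i : ℕ) - 1, by omega⟩ := by
    intro i
    exact Fin.snoc_castSucc (α := fun _ => Fin 2) a x ⟨(i : ℕ) - 1, by omega⟩
  simp only [h1]
  by_cases h : n = 0
  · subst h; simp
  · have h2 : (Fin.snoc (α := fun _ => Fin 2) x a : Fin (n + 1) → Fin 2)
      ⟨n - 1, by omega⟩ = x ⟨n - 1, by omega⟩ :=
      Fin.snoc_castSucc (α := fun _ => Fin 2) a x ⟨n - 1, by omega⟩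
    simp only [h, h2, if_false, dif_neg, not_false_iff]
    ring

lemma sum_snoc {α : Type*} [Fintype α] (n : ℕ) (F : (Fin (n + 1) → α) → ℝ) :
    ∑ x, F x = ∑ x : Fin n → α, ∑ a, F (Fin.snoc (α := fun _ => α) x a) := by
  rw [Finset.sum_comm, ← Fintype.sum_prod_type']
  exact (Equiv.sum_comp (Fin.snocEquiv (fun _ => α)) F).symm

lemma fwd_eq {K : ℕ} (θ : Param K) (n : ℕ) : ∀ (y : Fin n → Fin K) (b : Fin 2),
    fwd θ n y b = ∑ x, pathW θ n y x * nextW θ n x b := by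
  induction n with
  | zero => intro y b; simp [fwd, pathW, nextW]
  | succ n ih =>
    intro y b
    rw [sum_snoc]
    simp only [pathW_snoc, fwd, ih]
    rw [Finset.sum_comm]
    refine Finset.sum_congr rfl fun a _ => ?_
    rw [Finset.sum_mul, Finset.sum_mul]
    refine Finset.sum_congr rfl fun x _ => ?_
    have : nextW θ (n + 1) (Fin.snoc (α := fun _ => Fin 2) x a) b = transP θ a b := by
      unfold nextW
      rw [dif_neg (by omega)]
      congr 1
      exact Fin.snoc_last (α := fun _ => Fin 2) a x
    rw [this]

lemma pLaw_zero {K : ℕ} (θ : Param K) (y : Fin 0 → Fin K) : pLaw θ 0 y = 1 := by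
  simp [pLaw]

lemma pLaw_succ {K : ℕ} (θ : Param K) (n : ℕ) (y : Fin (n + 1) → Fin K) :
    pLaw θ (n + 1) y
      = ∑ a, fwd θ n (fun i => y i.castSucc) a * emit θ a (y (Fin.last n)) := by
  change ∑ x, pathW θ (n + 1) y x = _
  rw [sum_snoc]
  simp only [pathW_snoc, fwd_eq]
  rw [Finset.sum_comm]
  exact Finset.sum_congr rfl fun a _ => by rw [Finset.sum_mul]

lemma pLaw_eq_fwd {K : ℕ} (θ : Param K) (h : θ.p + θ.q ≠ 0) (n : ℕ) (y : Fin n → Fin K) :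
    pLaw θ n y = fwd θ n y 0 + fwd θ n y 1 := by
  cases n with
  | zero =>
    rw [pLaw_zero]; simp only [fwd, initD, Fin.isValue, one_ne_zero, if_true, if_false]
    field_simp; ring
  | succ n =>
    rw [pLaw_succ]
    simp only [fwd, Fin.sum_univ_two, transP, Fin.isValue, one_ne_zero, if_true, if_false]
    ring

lemma pLaw_nonneg {K : ℕ} (θ : Param K) (hv : Valid θ) (n : ℕ) (y : Fin n → Fin K) :
    0 ≤ pLaw θ n y := by
  obtain ⟨⟨hp0, hp1⟩, ⟨hq0, hq1⟩, hf0, hf1⟩ := hv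
  unfold pLaw
  refine Finset.sum_nonneg fun x _ => mul_nonneg (Finset.prod_nonneg fun i _ => ?_)
    (Finset.prod_nonneg fun i _ => ?_)
  · unfold initD transP
    split_ifs <;> first | positivity | linarith
  · unfold emit
    split_ifs
    · exact hf0.1 _
    · exact hf1.1 _

lemma snoc_cs {α : Type*} (n : ℕ) (x : Fin n → α) (a : α) :
    (fun i : Fin n => (Fin.snoc (α := fun _ => α) x a : Fin (n + 1) → α) i.castSucc) = x := by
  funext i; exact Fin.snoc_castSucc (α := fun _ => α) a x i

lemma snoc_l {α : Type*} (n : ℕ) (x : Fin n → α) (a : α) :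
    (Fin.snoc (α := fun _ => α) x a : Fin (n + 1) → α) (Fin.last n) = a :=
  Fin.snoc_last (α := fun _ => α) a x

lemma pLaw_sum {K : ℕ} (θ : Param K) (hv : Valid θ) (n : ℕ) :
    ∑ y, pLaw θ n y = 1 := by
  have hpq : θ.p + θ.q ≠ 0 := by
    have := hv.1.1; have := hv.2.1.1; positivity
  induction n with
  | zero => simp [pLaw_zero]
  | succ n ih =>
    rw [sum_snoc, ← ih]
    refine Finset.sum_congr rfl fun y _ => ?_
    simp only [pLaw_succ, snoc_cs, snoc_l, Fin.sum_univ_two]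
    rw [Finset.sum_add_distrib, ← Finset.mul_sum, ← Finset.mul_sum, pLaw_eq_fwd θ hpq]
    have h0 : ∑ k, emit θ 0 k = 1 := hv.2.2.1.2
    have h1 : ∑ k, emit θ 1 k = 1 := hv.2.2.2.2
    rw [h0, h1]; ring

lemma probOf_nonneg {K : ℕ} (θ : Param K) (hv : Valid θ) (n : ℕ)
    (E : (Fin n → Fin K) → Prop) : 0 ≤ probOf θ n E := by
  unfold probOf
  refine Finset.sum_nonneg fun y _ => ?_
  split_ifs
  · exact pLaw_nonneg θ hv n y
  · exact le_rfl

lemma probOf_le_one {K : ℕ} (θ : Param K) (hv : Valid θ) (n : ℕ)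
    (E : (Fin n → Fin K) → Prop) : probOf θ n E ≤ 1 := by
  rw [← pLaw_sum θ hv n]
  unfold probOf
  refine Finset.sum_le_sum fun y _ => ?_
  split_ifs
  · exact le_rfl
  · exact pLaw_nonneg θ hv n y

lemma unpack_pack {K : ℕ} (θ : Param K) (h : θ.p + θ.q ≠ 0)
    (hn : enormF (fun k => θ.f0 k - θ.f1 k) ≠ 0) : unpack (pack θ) = θ := by
  cases θ with
  | mk p q f0 f1 =>
    simp only at h hn
    simp only [unpack, pack, phiOf, psiOf, Param.mk.injEq]
    refine ⟨?_, ?_, ?_, ?_⟩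
    · field_simp; ring
    · field_simp; ring
    · funext k; field_simp; ring
    · funext k; field_simp; ring

lemma theta_unpack {K : ℕ} {L δ ε ζ : ℝ} (hζ : 0 < ζ) {θ : Param K}
    (hθ : θ ∈ ThetaL K L δ ε ζ) : unpack (pack θ) = θ := by
  obtain ⟨⟨hv, -, -, -, h⟩, -⟩ := hθ
  have := hv.1.1; have := hv.2.1.1
  exact unpack_pack θ (by positivity) (by linarith)

lemma le_sup {K : ℕ} {L δ ε ζ : ℝ} (hζ : 0 < ζ) (n : ℕ)
    (E : PP K → (Fin n → Fin K) → Prop) {θ : Param K} (hθ : θ ∈ ThetaL K L δ ε ζ) :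
    probOf θ n (E (pack θ)) ≤ ⨆ π ∈ PhiL K L δ ε ζ, probOf (unpack π) n (E π) := by
  have hb : BddAbove (Set.range fun π : PP K =>
      ⨆ (_ : π ∈ PhiL K L δ ε ζ), probOf (unpack π) n (E π)) := by
    refine ⟨1, ?_⟩
    rintro _ ⟨π, rfl⟩
    by_cases h : π ∈ PhiL K L δ ε ζ
    · simp only [h, ciSup_unique]
      obtain ⟨θ', h', rfl⟩ := h
      rw [theta_unpack hζ h']
      exact probOf_le_one _ h'.1.1 _ _
    · simp [h]
  refine le_ciSup_of_le hb (pack θ) ?_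
  have h : pack θ ∈ PhiL K L δ ε ζ := ⟨θ, hθ, rfl⟩
  simp only [h, ciSup_unique]
  rw [theta_unpack hζ hθ]

/-! ### Predictive recursion -/

/-- One step of the filter. -/
noncomputable def stepF (e s κ h u : ℝ) : ℝ := e * ((u + h * (s + κ * u)) / (1 + h * u))

/-- Predictive mean. -/
noncomputable def predU {K : ℕ} (e s κ : ℝ) (h : Fin K → ℝ) : (n : ℕ) → (Fin n → Fin K) → ℝ
  | 0, _ => 0
  | (n + 1), y => stepF e s κ (h (y (Fin.last n))) (predU e s κ h n (fun i => y i.castSucc))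

lemma step_bound {e s κ h u H : ℝ} (he0 : 0 ≤ e) (he : e ≤ 1 / 50) (hs0 : 0 ≤ s) (hs : s ≤ 1)
    (hκ : |κ| ≤ 1) (hh : |h| ≤ 1 / 2) (hH : |h| ≤ H) (hu1 : |u| ≤ 1) (hu : |u| ≤ 4 * e * H * s) :
    |stepF e s κ h u| ≤ 1 ∧ |stepF e s κ h u| ≤ 4 * e * H * s := by
  have hH0 : 0 ≤ H := (abs_nonneg _).trans hH
  have hhu : |h * u| ≤ 1 / 2 := by
    rw [abs_mul]; nlinarith [abs_nonneg h, abs_nonneg u]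
  have hD : 1 / 2 ≤ 1 + h * u := by linarith [(abs_le.mp hhu).1]
  have hκu : |κ * u| ≤ |u| := by
    rw [abs_mul]; nlinarith [abs_nonneg κ, abs_nonneg u]
  have hN : |u + h * (s + κ * u)| ≤ |u| + |h| * (s + |u|) := by
    refine (abs_add_le _ _).trans ?_
    rw [abs_mul]
    gcongr
    refine (abs_add_le _ _).trans ?_
    rw [abs_of_nonneg hs0]; gcongr
  have hS : |stepF e s κ h u| ≤ 2 * e * (|u| + |h| * (s + |u|)) := by
    unfold stepF
    rw [abs_mul, abs_div, abs_of_nonneg he0, abs_of_pos (by linarith : (0:ℝ) < 1 + h * u)]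
    have : |u + h * (s + κ * u)| / (1 + h * u) ≤ 2 * (|u| + |h| * (s + |u|)) := by
      rw [div_le_iff₀ (by linarith)]
      have h0 : 0 ≤ |u| + |h| * (s + |u|) := (abs_nonneg _).trans hN
      nlinarith
    nlinarith
  have h1 : |h| * |u| ≤ 1 / 2 * |u| := by gcongr
  constructor
  · have : |h| * s ≤ 1 / 2 * 1 := by gcongr
    nlinarith
  · have h2 : |h| * s ≤ H * s := by gcongr
    have h3 : 0 ≤ H * s := by positivity
    have h4 : |u| + |h| * (s + |u|) ≤ 2 * (H * s) := by
      have : |u| ≤ 4 * (1/50) * (H * s) := by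
        refine hu.trans ?_
        nlinarith
      nlinarith
    calc _ ≤ _ := hS
      _ ≤ 2 * e * (2 * (H * s)) := by gcongr
      _ = _ := by ring

lemma predU_bound {K : ℕ} {e s κ H : ℝ} {h : Fin K → ℝ} (he0 : 0 ≤ e) (he : e ≤ 1 / 50)
    (hs0 : 0 ≤ s) (hs : s ≤ 1) (hκ : |κ| ≤ 1) (hh : ∀ k, |h k| ≤ 1 / 2) (hH : ∀ k, |h k| ≤ H)
    (hH0 : 0 ≤ H) (n : ℕ) : ∀ y : Fin n → Fin K,
    |predU e s κ h n y| ≤ 1 ∧ |predU e s κ h n y| ≤ 4 * e * H * s := by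
  induction n with
  | zero => intro y; simp only [predU, abs_zero]; constructor <;> positivity
  | succ n ih =>
    intro y
    simp only [predU]
    exact step_bound he0 he hs0 hs hκ (hh _) (hH _) (ih _).1 (ih _).2

lemma prod_diff {h h' u u' H S : ℝ} (hH : |h| ≤ H) (hS : |h - h'| ≤ 2 * H * S) :
    |h * u - h' * u'| ≤ H * |u - u'| + 2 * H * S * |u'| := by
  have : h * u - h' * u' = h * (u - u') + (h - h') * u' := by ring
  rw [this]
  refine (abs_add_le _ _).trans ?_
  rw [abs_mul, abs_mul]
  gcongr

lemma step_diff {e s κ h h' u u' H S : ℝ} (he0 : 0 ≤ e) (he : e ≤ 1 / 50) (hs0 : 0 ≤ s)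
    (hs : s ≤ 1) (hκ : |κ| ≤ 1) (hh : |h| ≤ 1 / 2) (hh' : |h'| ≤ 1 / 2)
    (hH0 : 0 ≤ H) (hS0 : 0 ≤ S) (hS : |h - h'| ≤ 2 * H * S)
    (hu1 : |u| ≤ 1) (hu1' : |u'| ≤ 1) (hus : |u'| ≤ s) (hd : |u - u'| ≤ 80 * e * H * S * s) :
    |stepF e s κ h u - stepF e s κ h' u'| ≤ 80 * e * H * S * s := by
  have hhu : |h * u| ≤ 1 / 2 := by
    rw [abs_mul]; nlinarith [abs_nonneg h, abs_nonneg u]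
  have hhu' : |h' * u'| ≤ 1 / 2 := by
    rw [abs_mul]; nlinarith [abs_nonneg h', abs_nonneg u']
  have hD : 1 / 2 ≤ 1 + h * u := by linarith [(abs_le.mp hhu).1]
  have hD' : 1 / 2 ≤ 1 + h' * u' := by linarith [(abs_le.mp hhu').1]
  have hD2' : |1 + h' * u'| ≤ 3 / 2 := by
    rw [abs_of_pos (by linarith)]; linarith [(abs_le.mp hhu').2]
  have hHS : 0 ≤ H * S := by positivity
  set Δ := |u - u'| with hΔ
  have hΔ0 : 0 ≤ Δ := abs_nonneg _
  have hP : |h * u - h' * u'| ≤ 1 / 2 * Δ + 2 * H * S * s := by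
    have : h * u - h' * u' = h * (u - u') + (h - h') * u' := by ring
    rw [this]
    refine (abs_add_le _ _).trans ?_
    rw [abs_mul, abs_mul]
    gcongr
  have hN' : |u' + h' * (s + κ * u')| ≤ 2 := by
    have h1 : |κ * u'| ≤ 1 := by
      rw [abs_mul]; nlinarith [abs_nonneg κ, abs_nonneg u']
    have h2 : |s + κ * u'| ≤ 2 := by
      refine (abs_add_le _ _).trans ?_
      rw [abs_of_nonneg hs0]; linarith
    refine (abs_add_le _ _).trans ?_
    rw [abs_mul]
    nlinarith [abs_nonneg h', abs_nonneg (s + κ * u')]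
  have hNN : |(u + h * (s + κ * u)) - (u' + h' * (s + κ * u'))| ≤
      Δ + 2 * H * S * s + (1 / 2 * Δ + 2 * H * S * s) := by
    have : (u + h * (s + κ * u)) - (u' + h' * (s + κ * u'))
      = (u - u') + (h - h') * s + κ * (h * u - h' * u') := by ring
    rw [this]
    refine (abs_add_three _ _ _).trans ?_
    rw [abs_mul, abs_mul, abs_of_nonneg hs0]
    have : |κ| * |h * u - h' * u'| ≤ 1 * (1 / 2 * Δ + 2 * H * S * s) := by gcongr
    have : |h - h'| * s ≤ 2 * H * S * s := by gcongr
    linarith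
  have key : |(u + h * (s + κ * u)) / (1 + h * u) - (u' + h' * (s + κ * u')) / (1 + h' * u')|
      ≤ 13 * Δ + 40 * (H * S * s) := by
    rw [div_sub_div _ _ (by linarith) (by linarith), abs_div]
    rw [abs_of_pos (by nlinarith : (0:ℝ) < (1 + h * u) * (1 + h' * u')),
      div_le_iff₀ (by nlinarith)]
    have hq : 1 / 4 ≤ (1 + h * u) * (1 + h' * u') := by nlinarith
    have h0 : 0 ≤ H * S * s := by positivity
    have hnum : |(u + h * (s + κ * u)) * (1 + h' * u') - (1 + h * u) * (u' + h' * (s + κ * u'))|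
        ≤ (Δ + 2 * H * S * s + (1 / 2 * Δ + 2 * H * S * s)) * (3 / 2)
          + 2 * (1 / 2 * Δ + 2 * H * S * s) := by
      have : (u + h * (s + κ * u)) * (1 + h' * u') - (1 + h * u) * (u' + h' * (s + κ * u'))
        = ((u + h * (s + κ * u)) - (u' + h' * (s + κ * u'))) * (1 + h' * u')
          - (u' + h' * (s + κ * u')) * (h * u - h' * u') := by ring
      rw [this]
      refine (abs_sub _ _).trans ?_
      rw [abs_mul, abs_mul]
      gcongr
    nlinarith
  unfold stepF
  rw [← mul_sub, abs_mul, abs_of_nonneg he0]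
  have h0 : 0 ≤ H * S * s := by positivity
  calc _ ≤ e * (13 * Δ + 40 * (H * S * s)) := by gcongr
    _ ≤ e * (80 * (H * S * s)) := by
        gcongr
        have : e * (H * S * s) ≤ 1 / 50 * (H * S * s) := by gcongr
        nlinarith
    _ = _ := by ring

lemma predU_diff {K : ℕ} {e s κ H S : ℝ} {h h' : Fin K → ℝ} (he0 : 0 ≤ e) (he : e ≤ 1 / 50)
    (hs0 : 0 ≤ s) (hs : s ≤ 1) (hκ : |κ| ≤ 1) (hh : ∀ k, |h k| ≤ 1 / 2)
    (hh' : ∀ k, |h' k| ≤ 1 / 2) (hH0 : 0 ≤ H) (hS0 : 0 ≤ S)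
    (hS : ∀ k, |h k - h' k| ≤ 2 * H * S) (n : ℕ) : ∀ y : Fin n → Fin K,
    |predU e s κ h n y - predU e s κ h' n y| ≤ 80 * e * H * S * s := by
  induction n with
  | zero => intro y; simp only [predU, sub_self, abs_zero]; positivity
  | succ n ih =>
    intro y
    simp only [predU]
    have b := fun y => predU_bound he0 he hs0 hs hκ hh hh (by norm_num) n y
    have b' := fun y => predU_bound he0 he hs0 hs hκ hh' hh' (by norm_num) n y
    refine step_diff he0 he hs0 hs hκ (hh _) (hh' _) hH0 hS0 (hS _) (b _).1 (b' _).1 ?_ (ih _)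
    refine (b' _).2.trans ?_
    nlinarith

/-! ### Chi-square bound -/

lemma chi_step {K : ℕ} (hK : 0 < K) {a b : Fin K → ℝ} {B : ℝ} (ha : ∑ k, a k = 0)
    (hb : ∑ k, b k = 0) (hb2 : ∀ k, |b k| ≤ 1 / 2) (hab : ∀ k, |a k - b k| ≤ B) :
    ∑ k, ((1 + a k) / K) ^ 2 / ((1 + b k) / K) ≤ 1 + 2 * B ^ 2 := by
  have hK' : (0 : ℝ) < K := by exact_mod_cast hK
  have h1 : ∀ k, ((1 + a k) / K) ^ 2 / ((1 + b k) / K)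
      ≤ (1 / K : ℝ) * (1 + 2 * B ^ 2 + 2 * a k - b k) := by
    intro k
    have hp : 1 / 2 ≤ 1 + b k := by linarith [(abs_le.mp (hb2 k)).1]
    have hB : (a k - b k) ^ 2 ≤ B ^ 2 := sq_le_sq' (by linarith [(abs_le.mp (hab k)).1])
      (abs_le.mp (hab k)).2
    have e1 : ((1 + a k) / K) ^ 2 / ((1 + b k) / K)
      = (1 / K : ℝ) * (1 + 2 * a k - b k + (a k - b k) ^ 2 / (1 + b k)) := by
      have : (1 + b k) ≠ 0 := by linarith
      field_simp; ring
    rw [e1]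
    have : (a k - b k) ^ 2 / (1 + b k) ≤ 2 * B ^ 2 := by
      rw [div_le_iff₀ (by linarith)]; nlinarith [sq_nonneg B]
    gcongr
    linarith
  refine (Finset.sum_le_sum fun k _ => h1 k).trans (le_of_eq ?_)
  rw [← Finset.mul_sum, Finset.sum_sub_distrib, Finset.sum_add_distrib, ← Finset.mul_sum, ha, hb]
  simp only [Finset.sum_const, Finset.card_univ, Fintype.card_fin, nsmul_eq_mul]
  field_simp; ring

lemma chi_bound {K : ℕ} (hK : 0 < K) (P Q u v : (n : ℕ) → (Fin n → Fin K) → ℝ)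
    (h h' : Fin K → ℝ) {B : ℝ} (hh : ∑ k, h k = 0) (hh' : ∑ k, h' k = 0)
    (hP0 : ∀ y, P 0 y = 1) (hQ0 : ∀ y, Q 0 y = 1)
    (hP : ∀ n y, P (n + 1) y = P n (fun i => y i.castSucc) *
      ((1 + h (y (Fin.last n)) * u n (fun i => y i.castSucc)) / K))
    (hQ : ∀ n y, Q (n + 1) y = Q n (fun i => y i.castSucc) *
      ((1 + h' (y (Fin.last n)) * v n (fun i => y i.castSucc)) / K))
    (hv : ∀ n y k, |h' k * v n y| ≤ 1 / 2)
    (hB : ∀ n y k, |h k * u n y - h' k * v n y| ≤ B) (n : ℕ) :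
    (∀ y, 0 < Q n y) ∧ ∑ y, P n y ^ 2 / Q n y ≤ (1 + 2 * B ^ 2) ^ n := by
  have hK' : (0 : ℝ) < K := by exact_mod_cast hK
  induction n with
  | zero => simp [hP0, hQ0]
  | succ n ih =>
    constructor
    · intro y
      rw [hQ]
      have := (abs_le.mp (hv n (fun i => y i.castSucc) (y (Fin.last n)))).1
      have h2 : 0 < 1 + h' (y (Fin.last n)) * v n (fun i => y i.castSucc) := by linarith
      have := ih.1 (fun i => y i.castSucc)
      positivity
    · rw [sum_snoc, pow_succ]
      refine le_trans ?_ (mul_le_mul_of_nonneg_right ih.2 (by positivity))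
      rw [Finset.sum_mul]
      refine Finset.sum_le_sum fun y _ => ?_
      simp only [hP, hQ, snoc_cs, snoc_l, mul_pow, mul_div_mul_comm]
      rw [← Finset.mul_sum]
      have := ih.1 y
      refine mul_le_mul_of_nonneg_left ?_ (by positivity)
      refine chi_step hK (a := fun k => h k * u n y) (b := fun k => h' k * v n y) ?_ ?_
        (hv n y) (hB n y)
      · rw [← Finset.sum_mul, hh, zero_mul]
      · rw [← Finset.sum_mul, hh', zero_mul]

lemma tv_of_chi {α : Type*} [Fintype α] (P Q : α → ℝ) (hQ : ∀ y, 0 < Q y)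
    (hP1 : ∑ y, P y = 1) (hQ1 : ∑ y, Q y = 1) (hc : ∑ y, P y ^ 2 / Q y ≤ 2) :
    ∑ y, |P y - Q y| ≤ 1 := by
  have h1 : ∑ y, (P y - Q y) ^ 2 / Q y ≤ 1 := by
    have : ∀ y, (P y - Q y) ^ 2 / Q y = P y ^ 2 / Q y - 2 * P y + Q y := by
      intro y; have := (hQ y).ne'; field_simp; ring
    simp only [this]
    rw [Finset.sum_add_distrib, Finset.sum_sub_distrib, ← Finset.mul_sum, hP1, hQ1]
    linarith
  have h2 : ∀ y, |P y - Q y| ≤ ((P y - Q y) ^ 2 / Q y + Q y) / 2 := by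
    intro y
    have h := hQ y
    have : (P y - Q y) ^ 2 / Q y + Q y - 2 * |P y - Q y| = (|P y - Q y| - Q y) ^ 2 / Q y := by
      rw [← sq_abs (P y - Q y)]; field_simp; ring
    have h0 : 0 ≤ (|P y - Q y| - Q y) ^ 2 / Q y := by positivity
    linarith
  refine (Finset.sum_le_sum fun y _ => h2 y).trans ?_
  rw [← Finset.sum_div, Finset.sum_add_distrib, hQ1]
  linarith

lemma two_point {K : ℕ} (θ θ' : Param K) (hv : Valid θ) (hv' : Valid θ') (n : ℕ)
    (E E' : (Fin n → Fin K) → Prop) (hE : ∀ y, E y ∨ E' y)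
    (hTV : ∑ y, |pLaw θ n y - pLaw θ' n y| ≤ 1) :
    1 / 2 ≤ probOf θ n E + probOf θ' n E' := by
  classical
  have h0 : ∀ y, (pLaw θ n y + pLaw θ' n y - |pLaw θ n y - pLaw θ' n y|) / 2
      ≤ (if E y then pLaw θ n y else 0) + (if E' y then pLaw θ' n y else 0) := by
    intro y
    have a := pLaw_nonneg θ hv n y
    have b := pLaw_nonneg θ' hv' n y
    have c := le_abs_self (pLaw θ n y - pLaw θ' n y)
    have d := neg_abs_le (pLaw θ n y - pLaw θ' n y)
    rcases hE y with h | h <;> simp only [h, if_true] <;> split_ifs <;> linarith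
  have h1 := Finset.sum_le_sum fun y (_ : y ∈ Finset.univ) => h0 y
  rw [← Finset.sum_div, Finset.sum_sub_distrib, Finset.sum_add_distrib, pLaw_sum θ hv,
    pLaw_sum θ' hv', Finset.sum_add_distrib] at h1
  unfold probOf
  calc (1:ℝ) / 2 ≤ _ := by linarith
    _ ≤ _ := h1
    _ = _ := by congr! 

/-! ### The recursion for our parameters -/

/-- Parameter with uniform stationary density and difference vector `h / K`. -/
noncomputable def par {K : ℕ} (p q : ℝ) (h : Fin K → ℝ) : Param K where
  p := p
  q := q
  f0 := fun k => (1 + p / (p + q) * h k) / K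
  f1 := fun k => (1 - q / (p + q) * h k) / K

lemma par_rec {K : ℕ} {p q : ℝ} (hK : 0 < K) (hpq : p + q ≠ 0) (h : Fin K → ℝ)
    {e s κ : ℝ} (he : e = 1 - p - q) (hs : s = p / (p + q) * (q / (p + q)))
    (hκ : κ = (p - q) / (p + q))
    (hD : ∀ n y k, 1 + h k * predU e s κ h n y ≠ 0) (n : ℕ) :
    ∀ y, (pLaw (par p q h) (n + 1) y = pLaw (par p q h) n (fun i => y i.castSucc) *
      ((1 + h (y (Fin.last n)) * predU e s κ h n (fun i => y i.castSucc)) / K)) := by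
  have hK' : (K : ℝ) ≠ 0 := by exact_mod_cast hK.ne'
  have hpq' : (par p q h).p + (par p q h).q ≠ 0 := hpq
  have e0 : ∀ k, emit (par p q h) 0 k = (1 + p / (p + q) * h k) / K := fun k => by
    simp [emit, par]
  have e1 : ∀ k, emit (par p q h) 1 k = (1 - q / (p + q) * h k) / K := fun k => by
    simp [emit, par]
  have sum1 : q / (p + q) = 1 - p / (p + q) := by field_simp; ring
  have main : ∀ n y, p / (p + q) * fwd (par p q h) n y 0 - q / (p + q) * fwd (par p q h) n y 1
      = (fwd (par p q h) n y 0 + fwd (par p q h) n y 1) * predU e s κ h n y := by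
    intro n
    induction n with
    | zero => intro y; simp [fwd, predU, initD, par]; ring
    | succ n ih =>
      intro y
      have ih := ih (fun i => y i.castSucc)
      have hd := hD n (fun i => y i.castSucc) (y (Fin.last n))
      simp only [fwd, predU, Fin.sum_univ_two, e0, e1]
      have t00 : transP (par p q h) 0 0 = 1 - p := by simp [transP, par]
      have t01 : transP (par p q h) 0 1 = p := by simp [transP, par]
      have t10 : transP (par p q h) 1 0 = q := by simp [transP, par]
      have t11 : transP (par p q h) 1 1 = 1 - q := by simp [transP, par]
      rw [t00, t01, t10, t11]
      generalize fwd (par p q h) n (fun i => y i.castSucc) 0 = A at ih ⊢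
      generalize fwd (par p q h) n (fun i => y i.castSucc) 1 = B at ih ⊢
      generalize predU e s κ h n (fun i => y i.castSucc) = u at ih hd ⊢
      generalize h (y (Fin.last n)) = x at hd ⊢
      have hκ' : κ = p / (p + q) - q / (p + q) := by rw [hκ]; ring
      have hp : p = p / (p + q) * (1 - e) := by rw [he]; field_simp; ring
      have hq : q = q / (p + q) * (1 - e) := by rw [he]; field_simp; ring
      generalize p / (p + q) = r at *
      generalize q / (p + q) = t at *
      have l1 : A * ((1 + r * x) / K) * (1 - p) + B * ((1 - t * x) / K) * q
          + (A * ((1 + r * x) / K) * p + B * ((1 - t * x) / K) * (1 - q))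
          = (A + B) * (1 + x * u) / K := by
        have : A * ((1 + r * x) / K) * (1 - p) + B * ((1 - t * x) / K) * q
          + (A * ((1 + r * x) / K) * p + B * ((1 - t * x) / K) * (1 - q))
          = (A + B + x * (r * A - t * B)) / K := by ring
        rw [this, ih]; ring
      rw [l1]
      have l2 : (A + B) * (1 + x * u) / K * stepF e s κ x u
          = e * ((A + B) * u + x * (s * (A + B) + κ * ((A + B) * u))) / K := by
        unfold stepF; field_simp
      rw [l2, ← ih, hs, hκ', hp, hq, sum1]
      ring
  intro y
  rw [pLaw_succ, Fin.sum_univ_two, e0, e1, pLaw_eq_fwd _ hpq']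
  have := main n (fun i => y i.castSucc)
  generalize fwd (par p q h) n (fun i => y i.castSucc) 0 = A at *
  generalize fwd (par p q h) n (fun i => y i.castSucc) 1 = B at *
  generalize predU e s κ h n (fun i => y i.castSucc) = u at *
  generalize h (y (Fin.last n)) = x at *
  have h2 : A * ((1 + p / (p + q) * x) / K) + B * ((1 - q / (p + q) * x) / K)
    = (A + B + x * (p / (p + q) * A - q / (p + q) * B)) / K := by ring
  rw [h2, this]; ring

/-! ### Construction of the two hypotheses -/

lemma tv_par {K : ℕ} (hK : 0 < K) {δ ε H S : ℝ} (hδ0 : 0 < δ) (hδ : δ ≤ 1 / 6) (hε0 : 0 < ε)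
    (hε : ε ≤ 1 / 50) (hS0 : 0 ≤ S) (hH0 : 0 ≤ H) {h h' : Fin K → ℝ}
    (hsum : ∑ k, h k = 0) (hsum' : ∑ k, h' k = 0)
    (hh : ∀ k, |h k| ≤ 1 / 2) (hh' : ∀ k, |h' k| ≤ 1 / 2)
    (hH : ∀ k, |h k| ≤ H) (hH' : ∀ k, |h' k| ≤ H) (hS : ∀ k, |h k - h' k| ≤ 2 * H * S) (n : ℕ)
    (hn : n * (2 * (176 * ε * H ^ 2 * S * δ) ^ 2) ≤ 1 / 2)
    (hv : Valid (par δ (1 - δ - ε) h)) (hv' : Valid (par δ (1 - δ - ε) h')) :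
    ∑ y, |pLaw (par δ (1 - δ - ε) h) n y - pLaw (par δ (1 - δ - ε) h') n y| ≤ 1 := by
  set q := 1 - δ - ε with hq
  have hpq : δ + q = 1 - ε := by rw [hq]; ring
  have hpq0 : 0 < δ + q := by linarith
  have hq0 : 0 < q := by rw [hq]; linarith
  set s := δ / (δ + q) * (q / (δ + q)) with hs
  set κ := (δ - q) / (δ + q) with hκ
  have hr : δ / (δ + q) ≤ 2 * δ := by rw [div_le_iff₀ hpq0]; nlinarith
  have ht : q / (δ + q) ≤ 1 := by rw [div_le_one hpq0]; linarith
  have hs0 : 0 ≤ s := by rw [hs]; positivity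
  have hs2 : s ≤ 2 * δ := by
    have : s ≤ 2 * δ * 1 := by rw [hs]; gcongr
    linarith
  have hs1 : s ≤ 1 := by linarith
  have hκ1 : |κ| ≤ 1 := by
    rw [hκ, abs_div, abs_of_pos hpq0, div_le_one hpq0, abs_le]; constructor <;> linarith
  have b1 := fun n y => predU_bound (h := h) hε0.le hε hs0 hs1 hκ1 hh hH hH0 n y
  have b1' := fun n y => predU_bound (h := h') hε0.le hε hs0 hs1 hκ1 hh' hH' hH0 n y
  have pr : ∀ {x u : ℝ}, |x| ≤ 1 / 2 → |u| ≤ 1 → |x * u| ≤ 1 / 2 := by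
    intro x u hx hu
    rw [abs_mul]; nlinarith [abs_nonneg x, abs_nonneg u]
  have d := fun n y => predU_diff (h := h) (h' := h') hε0.le hε hs0 hs1 hκ1 hh hh' hH0 hS0 hS n y
  have he : ε = 1 - δ - q := by rw [hq]; ring
  have rec1 := par_rec hK hpq0.ne' h he hs hκ (fun n y k => by
    have := (abs_le.mp (pr (hh k) (b1 n y).1)).1
    linarith)
  have rec2 := par_rec hK hpq0.ne' h' he hs hκ (fun n y k => by
    have := (abs_le.mp (pr (hh' k) (b1' n y).1)).1
    linarith)
  have hchi := chi_bound hK (fun n y => pLaw (par δ q h) n y) (fun n y => pLaw (par δ q h') n y)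
    (predU ε s κ h) (predU ε s κ h') h h' (B := 176 * ε * H ^ 2 * S * δ) hsum hsum'
    (fun y => pLaw_zero _ _) (fun y => pLaw_zero _ _) rec1 rec2
    (fun n y k => pr (hh' k) (b1' n y).1) (fun n y k => by
      refine (prod_diff (hH k) (hS k)).trans ?_
      calc _ ≤ H * (80 * ε * H * S * s) + 2 * H * S * (4 * ε * H * s) := by
            gcongr
            · exact d n y
            · exact (b1' n y).2
        _ = 88 * ε * H ^ 2 * S * s := by ring
        _ ≤ 88 * ε * H ^ 2 * S * (2 * δ) := by gcongr
        _ = _ := by ring) n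
  refine tv_of_chi _ _ hchi.1 (pLaw_sum _ hv n) (pLaw_sum _ hv' n) (hchi.2.trans ?_)
  set x := 2 * (176 * ε * H ^ 2 * S * δ) ^ 2 with hx
  have hx0 : 0 ≤ x := by positivity
  calc (1 + x) ^ n ≤ (Real.exp x) ^ n := by
        gcongr; linarith [Real.add_one_le_exp x]
    _ = Real.exp (n * x) := by rw [Real.exp_nat_mul]
    _ ≤ Real.exp (1 / 2) := Real.exp_le_exp.mpr hn
    _ ≤ 2 := by
        have h1 : Real.exp (1 / 2) ^ 2 = Real.exp 1 := by
          rw [← Real.exp_nat_mul]; norm_num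
        have h2 := Real.exp_one_lt_d9
        have h3 := Real.exp_pos (1 / 2)
        nlinarith

lemma par_valid {K : ℕ} (hK : 0 < K) {δ ε : ℝ} (hδ0 : 0 < δ) (hδ : δ ≤ 1 / 6) (hε0 : 0 < ε)
    (hε : ε ≤ 1 / 50) {h : Fin K → ℝ} (hsum : ∑ k, h k = 0) (hh : ∀ k, |h k| ≤ 1 / 2) :
    Valid (par δ (1 - δ - ε) h) := by
  have hK' : (0 : ℝ) < K := by exact_mod_cast hK
  have hpq : 0 < δ + (1 - δ - ε) := by linarith
  have hq0 : 0 < 1 - δ - ε := by linarith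
  have t1 : ∀ r : ℝ, 0 ≤ r → r ≤ 1 → ∀ k, |r * h k| ≤ 1 := by
    intro r h0 h1 k
    rw [abs_mul, abs_of_nonneg h0]; nlinarith [abs_nonneg (h k), hh k]
  have r1 : δ / (δ + (1 - δ - ε)) ≤ 1 := by rw [div_le_one hpq]; linarith
  have r2 : (1 - δ - ε) / (δ + (1 - δ - ε)) ≤ 1 := by rw [div_le_one hpq]; linarith
  refine ⟨⟨hδ0, ?_⟩, ⟨hq0, ?_⟩, ⟨fun k => ?_, ?_⟩, ⟨fun k => ?_, ?_⟩⟩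
  · simp only [par]; linarith
  · simp only [par]; linarith
  · have := (abs_le.mp (t1 _ (by positivity) r1 k)).1
    exact div_nonneg (by linarith) hK'.le
  · simp only [par]
    rw [← Finset.sum_div, Finset.sum_add_distrib, ← Finset.mul_sum, hsum]
    simp [hK'.ne']
  · have := (abs_le.mp (t1 _ (by positivity) r2 k)).2
    exact div_nonneg (by linarith) hK'.le
  · simp only [par]
    rw [← Finset.sum_div, Finset.sum_sub_distrib, ← Finset.mul_sum, hsum]
    simp [hK'.ne']

lemma par_enorm {K : ℕ} (hK : 0 < K) {p q ζ : ℝ} (hpq : p + q ≠ 0) (hζ : 0 < ζ)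
    {v : Fin K → ℝ} (hv : ∑ k, v k ^ 2 = 1) :
    (∀ k, (par p q (fun k => K * ζ * v k)).f0 k - (par p q (fun k => K * ζ * v k)).f1 k
      = ζ * v k) ∧
    enormF (fun k => (par p q (fun k => K * ζ * v k)).f0 k
      - (par p q (fun k => K * ζ * v k)).f1 k) = ζ := by
  have hK' : (0 : ℝ) < K := by exact_mod_cast hK
  have h1 : ∀ k, (par p q (fun k => K * ζ * v k)).f0 k - (par p q (fun k => K * ζ * v k)).f1 k
      = ζ * v k := by
    intro k; simp only [par]; field_simp; ring
  refine ⟨h1, ?_⟩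
  unfold enormF
  simp only [h1, mul_pow]
  rw [← Finset.mul_sum, hv, mul_one, Real.sqrt_sq hζ.le]

lemma par_psi {K : ℕ} (hK : 0 < K) {p q ζ : ℝ} (hpq : p + q ≠ 0) (hζ : 0 < ζ)
    {v : Fin K → ℝ} (hv : ∑ k, v k ^ 2 = 1) :
    (pack (par p q (fun k => K * ζ * v k))).2.2 = v := by
  obtain ⟨h1, h2⟩ := par_enorm hK hpq hζ hv
  funext k
  simp only [pack, psiOf]
  rw [h2, h1]; field_simp

lemma exists_v (K : ℕ) (hK : 2 < K) : ∃ v : Fin K → ℝ, ∑ k, v k = 0 ∧ ∑ k, v k ^ 2 = 1 ∧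
    ∀ k, |v k| ≤ 1 / Real.sqrt (2 * ((K / 2 : ℕ) : ℝ)) := by
  set j := K / 2 with hj
  have hj1 : 1 ≤ j := by omega
  have hj' : (0 : ℝ) < j := by exact_mod_cast hj1
  set m := Real.sqrt (2 * (j : ℝ)) with hm
  have hm0 : 0 < m := Real.sqrt_pos.mpr (by positivity)
  have hm2 : m ^ 2 = 2 * j := Real.sq_sqrt (by positivity)
  have hsub : Finset.range (2 * j) ⊆ Finset.range K := by
    intro x hx; simp only [Finset.mem_range] at *; omega
  have hs : ∀ F : ℕ → ℝ, (∑ k : Fin K, if (k : ℕ) < 2 * j then F k else 0)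
      = ∑ k ∈ Finset.range (2 * j), F k := by
    intro F
    rw [Fin.sum_univ_eq_sum_range (fun k => if k < 2 * j then F k else 0) K,
      ← Finset.sum_subset hsub]
    · refine Finset.sum_congr rfl fun k hk => ?_
      rw [if_pos (Finset.mem_range.mp hk)]
    · intro k _ hk
      rw [if_neg (fun h => hk (Finset.mem_range.mpr h))]
  refine ⟨fun k => if (k : ℕ) < 2 * j then (-1) ^ (k : ℕ) / m else 0, ?_, ?_, ?_⟩
  · rw [hs (fun k => (-1) ^ k / m), ← Finset.sum_div]
    have : ∀ i : ℕ, ∑ k ∈ Finset.range (2 * i), (-1 : ℝ) ^ k = 0 := by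
      intro i
      induction i with
      | zero => simp
      | succ i ih =>
        rw [show 2 * (i + 1) = 2 * i + 1 + 1 by ring, Finset.sum_range_succ,
          Finset.sum_range_succ, ih]
        ring
    rw [this, zero_div]
  · have : ∀ k : Fin K, (if (k : ℕ) < 2 * j then (-1 : ℝ) ^ (k : ℕ) / m else 0) ^ 2
        = if (k : ℕ) < 2 * j then (fun _ : ℕ => 1 / m ^ 2) k else 0 := by
      intro k
      split_ifs
      · rw [div_pow, ← pow_mul, mul_comm, pow_mul]; norm_num
      · norm_num
    simp only [this]
    rw [hs (fun _ => 1 / m ^ 2)]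
    simp only [Finset.sum_const, Finset.card_range, nsmul_eq_mul]
    rw [hm2]; push_cast; field_simp
  · intro k
    simp only
    split_ifs
    · rw [abs_div, abs_pow, abs_neg, abs_one, one_pow, abs_of_pos hm0]
    · rw [abs_zero]; positivity

lemma exists_w (K : ℕ) (hK : 2 < K) (v : Fin K → ℝ) : ∃ w : Fin K → ℝ, ∑ k, w k = 0 ∧
    ∑ k, w k ^ 2 = 1 ∧ ∑ k, v k * w k = 0 := by
  let A : Matrix (Fin 2) (Fin K) ℝ := Matrix.of ![fun _ => 1, v]
  have hker : LinearMap.ker (Matrix.toLin' A) ≠ ⊥ := by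
    apply LinearMap.ker_ne_bot_of_finrank_lt
    simpa using hK
  obtain ⟨x, hx, hx0⟩ := Submodule.exists_mem_ne_zero_of_ne_bot hker
  rw [LinearMap.mem_ker, Matrix.toLin'_apply] at hx
  have h1 : ∑ k, x k = 0 := by
    have := congrFun hx 0
    simpa [A, Matrix.mulVec, dotProduct] using this
  have h2 : ∑ k, v k * x k = 0 := by
    have := congrFun hx 1
    simpa [A, Matrix.mulVec, dotProduct] using this
  have hpos : 0 < ∑ k, x k ^ 2 := by
    obtain ⟨k, hk⟩ := Function.ne_iff.mp hx0
    exact Finset.sum_pos' (fun i _ => sq_nonneg _) ⟨k, Finset.mem_univ _, by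
      have : x k ≠ 0 := hk
      positivity⟩
  set N := Real.sqrt (∑ k, x k ^ 2) with hN
  have hN2 : N ^ 2 = ∑ k, x k ^ 2 := Real.sq_sqrt hpos.le
  refine ⟨fun k => x k / N, ?_, ?_, ?_⟩
  · rw [← Finset.sum_div, h1, zero_div]
  · simp only [div_pow]
    rw [← Finset.sum_div, hN2, div_self hpos.ne']
  · simp only [← mul_div_assoc]
    rw [← Finset.sum_div, h2, zero_div]

lemma enormF_sq {α : Type*} [Fintype α] (g : α → ℝ) : enormF g ^ 2 = ∑ a, g a ^ 2 :=
  Real.sq_sqrt (Finset.sum_nonneg fun _ _ => sq_nonneg _)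

lemma sep {K : ℕ} {v v' : Fin K → ℝ} {T : ℝ} (h1 : 4 * T ≤ ∑ k, (v k - v' k) ^ 2)
    (h2 : 4 * T ≤ ∑ k, (v k + v' k) ^ 2) (x : Fin K → ℝ) :
    T ≤ (min (enormF fun k => x k - v k) (enormF fun k => x k + v k)) ^ 2 ∨
    T ≤ (min (enormF fun k => x k - v' k) (enormF fun k => x k + v' k)) ^ 2 := by
  have key : ∀ a b : Fin K → ℝ, ∑ k, (a k - b k) ^ 2 ≤ 2 * ∑ k, a k ^ 2 + 2 * ∑ k, b k ^ 2 := by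
    intro a b
    rw [Finset.mul_sum, Finset.mul_sum, ← Finset.sum_add_distrib]
    refine Finset.sum_le_sum fun k _ => ?_
    nlinarith [sq_nonneg (a k + b k)]
  by_contra! hcon
  obtain ⟨c1, c2⟩ := hcon
  have e1 : ∀ k, ((x k - v' k) - (x k - v k)) ^ 2 = (v k - v' k) ^ 2 := fun k => by ring
  have e2 : ∀ k, ((x k + v' k) - (x k - v k)) ^ 2 = (v k + v' k) ^ 2 := fun k => by ring
  have e3 : ∀ k, ((x k - v' k) - (x k + v k)) ^ 2 = (v k + v' k) ^ 2 := fun k => by ring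
  have e4 : ∀ k, ((x k + v' k) - (x k + v k)) ^ 2 = (v k - v' k) ^ 2 := fun k => by ring
  have k1 := key (fun k => x k - v' k) (fun k => x k - v k)
  have k2 := key (fun k => x k + v' k) (fun k => x k - v k)
  have k3 := key (fun k => x k - v' k) (fun k => x k + v k)
  have k4 := key (fun k => x k + v' k) (fun k => x k + v k)
  simp only [e1] at k1
  simp only [e2] at k2
  simp only [e3] at k3
  simp only [e4] at k4
  rcases min_choice (enormF fun k => x k - v k) (enormF fun k => x k + v k) with h | h <;>
  rcases min_choice (enormF fun k => x k - v' k) (enormF fun k => x k + v' k) with h' | h' <;>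
  rw [h, enormF_sq] at c1 <;> rw [h', enormF_sq] at c2 <;> linarith

lemma abs_le_one_of_unit {K : ℕ} {w : Fin K → ℝ} (h : ∑ k, w k ^ 2 = 1) (k : Fin K) :
    |w k| ≤ 1 := by
  have : w k ^ 2 ≤ 1 := by
    rw [← h]
    exact Finset.single_le_sum (f := fun k => w k ^ 2) (fun i _ => sq_nonneg _)
      (Finset.mem_univ k)
  exact (sq_le_one_iff_abs_le_one _).mp this

lemma par_mem {K : ℕ} (hK : 0 < K) {L δ ε ζ : ℝ} (hL : L ≤ 1 / 3) (hδ0 : 0 < δ)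
    (hδ : δ ≤ 1 / 6) (hε0 : 0 < ε) (hε : ε ≤ 1 / 50) (hζ : 0 < ζ) {v : Fin K → ℝ}
    (hv : ∑ k, v k ^ 2 = 1) (hval : Valid (par δ (1 - δ - ε) (fun k => K * ζ * v k))) :
    par δ (1 - δ - ε) (fun k => K * ζ * v k) ∈ ThetaL K L δ ε ζ := by
  have h1 := (par_enorm (p := δ) (q := 1 - δ - ε) hK (by linarith) hζ hv).2
  have h2 : |1 - δ - (1 - δ - ε)| = ε := by
    rw [show 1 - δ - (1 - δ - ε) = ε by ring, abs_of_pos hε0]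
  refine ⟨⟨hval, le_rfl, ?_, ?_, h1.ge⟩, ?_⟩
  · simp only [par]; linarith
  · simp only [par]; rw [h2]
  · simp only [par, Set.mem_ofPred_eq]; rw [h2]; linarith

set_option maxHeartbeats 2000000

theorem statement18 (K : ℕ) (hK : 2 < K) :
    ∃ c ε₀ : ℝ, 0 < c ∧ 0 < ε₀ ∧
      ∀ (L δ ε ζ : ℝ) (n : ℕ),
        0 < L → L ≤ 1 / 3 →
        δ ∈ Set.Ioo (0 : ℝ) 1 → δ ≤ 1 / 6 →
        ε ∈ Set.Ioo (0 : ℝ) 1 → ε ≤ ε₀ →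
        0 < ζ → ζ ≤ Real.sqrt (2 * ((K / 2 : ℕ) : ℝ)) / (4 * K) →
        1 ≤ n * δ ^ 2 * ε ^ 2 * ζ ^ 4 →
        ∀ est : (Fin n → Fin K) → (Fin K → ℝ),
          1 / 4 ≤ ⨆ π ∈ PhiL K L δ ε ζ,
            probOf (unpack π) n (fun y =>
              c / (n * δ ^ 2 * ε ^ 2 * ζ ^ 4)
                ≤ (min (enormF fun k => est y k - π.2.2 k)
                    (enormF fun k => est y k + π.2.2 k)) ^ 2) := by
  have hK0 : 0 < K := by omega
  have hK' : (3 : ℝ) ≤ K := by exact_mod_cast hK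
  set τ : ℝ := 1 / (200000 * (K : ℝ) ^ 4) with hτ
  have hτ0 : 0 < τ := by rw [hτ]; positivity
  refine ⟨τ / 4, 1 / 50, by positivity, by norm_num, ?_⟩
  rintro L δ ε ζ n - hL ⟨hδ0, -⟩ hδ ⟨hε0, -⟩ hε hζ hζ2 hn est
  obtain ⟨v, hv0, hv1, hvm⟩ := exists_v K hK
  obtain ⟨w, hw0, hw1, hvw⟩ := exists_w K hK v
  set m := Real.sqrt (2 * ((K / 2 : ℕ) : ℝ)) with hm
  have hj : (1 : ℝ) ≤ ((K / 2 : ℕ) : ℝ) := by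
    have : 1 ≤ K / 2 := by omega
    exact_mod_cast this
  have hm0 : 0 < m := Real.sqrt_pos.mpr (by positivity)
  have hmK : m ≤ K := by
    have h1 : 2 * ((K / 2 : ℕ) : ℝ) ≤ K := by
      have : 2 * (K / 2) ≤ K := by omega
      exact_mod_cast this
    rw [hm]
    refine Real.sqrt_le_iff.mpr ⟨by linarith, by nlinarith⟩
  set N : ℝ := n * δ ^ 2 * ε ^ 2 * ζ ^ 4 with hN
  have hN0 : 0 < N := by linarith
  set S := Real.sqrt (τ / N) with hS
  have hS0 : 0 ≤ S := Real.sqrt_nonneg _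
  have hS2 : S ^ 2 = τ / N := Real.sq_sqrt (by positivity)
  have hSτ : S ^ 2 ≤ τ := by rw [hS2]; exact div_le_self hτ0.le hn
  have hτK : τ ≤ (1 / K) ^ 2 := by
    rw [hτ, div_pow, one_pow]
    apply one_div_le_one_div_of_le (by positivity)
    nlinarith [sq_nonneg ((K : ℝ) ^ 2), show (9:ℝ) ≤ (K : ℝ) ^ 2 by nlinarith]
  have hSK : S ≤ 1 / K := (le_abs_self S).trans (abs_le_of_sq_le_sq (hSτ.trans hτK) (by positivity))
  have hSm : S ≤ 1 / m := hSK.trans (one_div_le_one_div_of_le hm0 hmK)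
  have hS1 : S ≤ 1 := hSK.trans (by rw [div_le_one (by linarith)]; linarith)
  set C := Real.sqrt (1 - S ^ 2) with hC
  have hC0 : 0 ≤ C := Real.sqrt_nonneg _
  have hC2 : C ^ 2 = 1 - S ^ 2 := Real.sq_sqrt (by nlinarith)
  have hC1 : C ≤ 1 := by nlinarith
  set v' : Fin K → ℝ := fun k => C * v k + S * w k with hv'
  have hv'0 : ∑ k, v' k = 0 := by
    simp only [hv']
    rw [Finset.sum_add_distrib, ← Finset.mul_sum, ← Finset.mul_sum, hv0, hw0]; ring
  have hvv' : ∑ k, v k * v' k = C := by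
    have : ∀ k, v k * v' k = C * v k ^ 2 + S * (v k * w k) := fun k => by simp only [hv']; ring
    simp only [this]
    rw [Finset.sum_add_distrib, ← Finset.mul_sum, ← Finset.mul_sum, hv1, hvw]; ring
  have hv'1 : ∑ k, v' k ^ 2 = 1 := by
    have : ∀ k, v' k ^ 2 = C ^ 2 * v k ^ 2 + 2 * C * S * (v k * w k) + S ^ 2 * w k ^ 2 :=
      fun k => by simp only [hv']; ring
    simp only [this]
    rw [Finset.sum_add_distrib, Finset.sum_add_distrib, ← Finset.mul_sum, ← Finset.mul_sum,
      ← Finset.mul_sum, hv1, hw1, hvw, hC2]; ring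
  have hd1 : ∑ k, (v k - v' k) ^ 2 = 2 - 2 * C := by
    have : ∀ k, (v k - v' k) ^ 2 = v k ^ 2 + v' k ^ 2 - 2 * (v k * v' k) := fun k => by ring
    simp only [this]
    rw [Finset.sum_sub_distrib, Finset.sum_add_distrib, ← Finset.mul_sum, hv1, hv'1, hvv']; ring
  have hd2 : ∑ k, (v k + v' k) ^ 2 = 2 + 2 * C := by
    have : ∀ k, (v k + v' k) ^ 2 = v k ^ 2 + v' k ^ 2 + 2 * (v k * v' k) := fun k => by ring
    simp only [this]
    rw [Finset.sum_add_distrib, Finset.sum_add_distrib, ← Finset.mul_sum, hv1, hv'1, hvv']; ring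
  have hT : 4 * (τ / 4 / N) = S ^ 2 := by rw [hS2]; ring
  have hsep := sep (v := v) (v' := v') (T := τ / 4 / N)
    (by rw [hT, hd1]; nlinarith [sq_nonneg (1 - C)]) (by rw [hT, hd2]; nlinarith)
  have hvle := abs_le_one_of_unit hv1
  have hwle := abs_le_one_of_unit hw1
  have hv'le := abs_le_one_of_unit hv'1
  have hv'm : ∀ k, |v' k| ≤ 2 / m := by
    intro k
    refine (abs_add_le _ _).trans ?_
    rw [abs_mul, abs_mul, abs_of_nonneg hC0, abs_of_nonneg hS0]
    have h1 : C * |v k| ≤ 1 * (1 / m) := by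
      have := hvm k
      gcongr
    have h2 : S * |w k| ≤ (1 / m) * 1 := by
      have := hwle k
      gcongr
    calc _ ≤ 1 * (1 / m) + (1 / m) * 1 := add_le_add h1 h2
      _ = _ := by ring
  have hKζ : 0 < K * ζ := by positivity
  have hhalf : ∀ x : ℝ, |x| ≤ 2 / m → |K * ζ * x| ≤ 1 / 2 := by
    intro x hx
    rw [abs_mul, abs_of_pos hKζ]
    calc K * ζ * |x| ≤ K * (m / (4 * K)) * (2 / m) := by gcongr
      _ = 1 / 2 := by field_simp; norm_num
  have hH : ∀ x : ℝ, |x| ≤ 1 → |K * ζ * x| ≤ K * ζ := by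
    intro x hx
    rw [abs_mul, abs_of_pos hKζ]
    nlinarith
  have hvm2 : ∀ k, |v k| ≤ 2 / m := fun k => (hvm k).trans (by gcongr; norm_num)
  have hs1 : ∑ k, K * ζ * v k = 0 := by rw [← Finset.mul_sum, hv0, mul_zero]
  have hs2 : ∑ k, K * ζ * v' k = 0 := by rw [← Finset.mul_sum, hv'0, mul_zero]
  have hval := par_valid hK0 hδ0 hδ hε0 hε hs1 (fun k => hhalf _ (hvm2 k))
  have hval' := par_valid hK0 hδ0 hδ hε0 hε hs2 (fun k => hhalf _ (hv'm k))
  have hdiff : ∀ k, |K * ζ * v k - K * ζ * v' k| ≤ 2 * (K * ζ) * S := by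
    intro k
    rw [← mul_sub, abs_mul, abs_of_pos hKζ]
    have : v k - v' k = (1 - C) * v k - S * w k := by simp only [hv']; ring
    have h3 : |v k - v' k| ≤ 2 * S := by
      rw [this]
      refine (abs_sub _ _).trans ?_
      rw [abs_mul, abs_mul, abs_of_nonneg hS0, abs_of_nonneg (by linarith : 0 ≤ 1 - C)]
      have h1C : 1 - C ≤ S := by nlinarith
      have := hvle k
      have := hwle k
      calc _ ≤ S * 1 + S * 1 := by gcongr
        _ = _ := by ring
    calc _ ≤ K * ζ * (2 * S) := by gcongr
      _ = _ := by ring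
  have hnn : n * (2 * (176 * ε * (K * ζ) ^ 2 * S * δ) ^ 2) ≤ 1 / 2 := by
    have h1 : n * (2 * (176 * ε * (K * ζ) ^ 2 * S * δ) ^ 2)
        = 61952 * (K : ℝ) ^ 4 * (N * S ^ 2) := by rw [hN]; ring
    rw [h1, hS2, mul_div_cancel₀ _ hN0.ne', hτ]
    have : (K : ℝ) ≠ 0 := by linarith
    field_simp; norm_num
  have hTV := tv_par hK0 hδ0 hδ hε0 hε hS0 hKζ.le hs1 hs2 (fun k => hhalf _ (hvm2 k))
    (fun k => hhalf _ (hv'm k)) (fun k => hH _ (hvle k)) (fun k => hH _ (hv'le k)) hdiff n hnn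
    hval hval'
  have hmem := par_mem hK0 hL hδ0 hδ hε0 hε hζ hv1 hval
  have hmem' := par_mem hK0 hL hδ0 hδ hε0 hε hζ hv'1 hval'
  have l1 := le_sup hζ n (fun π y => τ / 4 / N ≤ (min (enormF fun k => est y k - π.2.2 k)
                    (enormF fun k => est y k + π.2.2 k)) ^ 2) hmem
  have l2 := le_sup hζ n (fun π y => τ / 4 / N ≤ (min (enormF fun k => est y k - π.2.2 k)
                    (enormF fun k => est y k + π.2.2 k)) ^ 2) hmem'
  rw [par_psi hK0 (by linarith) hζ hv1] at l1
  rw [par_psi hK0 (by linarith) hζ hv'1] at l2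
  have l3 := two_point _ _ hval hval' n _ _ (fun y => hsep (est y)) hTV
  linarith

end PaperHMM
end

section
/- There exist constants c,C>0 (depending only on K) such that for every η∈[0,1] and every (φ,ψ) in ∪_{δ,ε,ζ}Φ(δ,ε,ζ) the following hold: (i) if η < c·(1−φ₁²)·φ₂²·φ₃³ then ω₁(φ,ψ;η) ≤ C·η/(φ₂²·φ₃³); (ii) if η < c·(1−φ₁²)·|φ₂|·φ₃² then ω₂(φ,ψ;η) ≤ C·η/((1−φ₁²)·|φ₂|·φ₃²); (iii) if η < c·(1−φ₁²)·φ₂²·φ₃³ then ω₃(φ,ψ;η) ≤ C·η/((1−φ₁²)·φ₂²·φ₃²). -/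
open scoped BigOperators

namespace PaperHMM

/-- Scalar core: part (ii). -/
lemma core_two (b r b' r' η : ℝ) (hb : |b| ≤ 1) (hη : 0 ≤ η) (hlt : η < |r| / 2)
    (h1 : |r - r'| ≤ η) (h2 : |b * r - b' * r'| ≤ η) :
    |b - b'| * |r| ≤ 4 * η := by
  have hr' : |r| / 2 ≤ |r'| := by
    have := abs_sub_abs_le_abs_sub r r'
    linarith
  have key : |b - b'| * |r'| ≤ 2 * η := by
    rw [← abs_mul]
    have e : (b - b') * r' = (b * r - b' * r') - b * (r - r') := by ring
    rw [e]
    have := abs_sub (b * r - b' * r') (b * (r - r'))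
    rw [abs_mul b] at this
    have h3 : |b| * |r - r'| ≤ 1 * η := mul_le_mul hb h1 (abs_nonneg _) zero_le_one
    linarith
  have := mul_le_mul_of_nonneg_left hr' (abs_nonneg (b - b'))
  linarith

set_option maxHeartbeats 1000000 in
/-- Scalar core: parts (i), (iii), in normalised form. -/
lemma core_main (x b z x' b' z' e : ℝ) (hx : x ^ 2 < 1) (hb0 : b ≠ 0) (hb : |b| ≤ 1)
    (hz : 0 < z) (hz2 : z ≤ 2) (hz' : 0 < z') (hx' : x' ^ 2 < 1) (hb0' : b' ≠ 0)
    (he : 0 ≤ e) (hc : e < 1 / 1000)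
    (h1 : |(1 - x ^ 2) * b * z ^ 2 / 4 - (1 - x' ^ 2) * b' * z' ^ 2 / 4|
      ≤ e * (1 - x ^ 2) * b ^ 2 * z ^ 3)
    (h2 : |b * ((1 - x ^ 2) * b * z ^ 2 / 4) - b' * ((1 - x' ^ 2) * b' * z' ^ 2 / 4)|
      ≤ e * (1 - x ^ 2) * b ^ 2 * z ^ 3)
    (h3 : |x * b * z * ((1 - x ^ 2) * b * z ^ 2 / 4) - x' * b' * z' * ((1 - x' ^ 2) * b' * z' ^ 2 / 4)|
      ≤ e * (1 - x ^ 2) * b ^ 2 * z ^ 3) :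
    |z - z'| ≤ 85 * e * z ∧ |x - x'| ≤ 1000 * e * (1 - x ^ 2) := by
  obtain ⟨a, ha⟩ : ∃ a, a = 1 - x ^ 2 := ⟨_, rfl⟩
  obtain ⟨a', ha'⟩ : ∃ a', a' = 1 - x' ^ 2 := ⟨_, rfl⟩
  rw [← ha] at h1 h2 h3 ⊢
  rw [← ha'] at h1 h2 h3
  have hapos : 0 < a := by linarith
  have ha1 : a ≤ 1 := by nlinarith [sq_nonneg x]
  have ha'pos : 0 < a' := by linarith
  have hbpos : 0 < b ^ 2 := by positivity
  have hbabs : 0 < |b| := abs_pos.mpr hb0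
  have hxabs : |x| ≤ 1 := by
    rw [← sq_le_one_iff_abs_le_one]; exact hx.le
  obtain ⟨D, hD⟩ : ∃ D, D = a * b ^ 2 * z ^ 2 := ⟨_, rfl⟩
  have hDpos : 0 < D := by rw [hD]; positivity
  obtain ⟨η, hη⟩ : ∃ η, η = e * a * b ^ 2 * z ^ 3 := ⟨_, rfl⟩
  rw [← hη] at h1 h2 h3
  have hηD : η = e * z * D := by rw [hη, hD]; ring
  have hη0 : 0 ≤ η := by rw [hηD]; positivity
  obtain ⟨M', hM'⟩ : ∃ M', M' = b' * (a' * b' * z' ^ 2 / 4) := ⟨_, rfl⟩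
  have hM : b * (a * b * z ^ 2 / 4) = D / 4 := by rw [hD]; ring
  rw [hM, ← hM'] at h2
  have hez : e * z ≤ 2 / 1000 := by nlinarith
  have hηsmall : η ≤ 2 / 1000 * D := by
    rw [hηD]; exact mul_le_mul_of_nonneg_right hez hDpos.le
  have hM'low : D / 5 ≤ M' := by
    have := (abs_le.mp h2).2
    linarith
  have hM'pos : 0 < M' := by linarith
  -- u
  have hu : |x * z - x' * z'| ≤ 15 * e * z := by
    have e1 : (x * z - x' * z') * M' =
        (x * b * z * (a * b * z ^ 2 / 4) - x' * b' * z' * (a' * b' * z' ^ 2 / 4))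
          - x * z * (D / 4 - M') := by rw [hM', ← hM]; ring
    have e2 : |x * z - x' * z'| * M' ≤ 3 * η := by
      rw [← abs_of_pos hM'pos, ← abs_mul, e1]
      have := abs_sub (x * b * z * (a * b * z ^ 2 / 4) - x' * b' * z' * (a' * b' * z' ^ 2 / 4))
          (x * z * (D / 4 - M'))
      rw [abs_mul (x * z)] at this
      have hxz : |x * z| ≤ 2 := by
        rw [abs_mul, abs_of_pos hz]
        nlinarith [abs_nonneg x]
      have := mul_le_mul hxz h2 (abs_nonneg _) (by norm_num)
      linarith
    have e3 : |x * z - x' * z'| * (D / 5) ≤ |x * z - x' * z'| * M' :=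
      mul_le_mul_of_nonneg_left hM'low (abs_nonneg _)
    have e4 : |x * z - x' * z'| * D ≤ (15 * e * z) * D := by
      rw [hηD] at e2; linarith
    exact le_of_mul_le_mul_right e4 hDpos
  -- v
  have hv : |a * z ^ 2 / 4 - a' * z' ^ 2 / 4| ≤ 5 * e * a * z ^ 3 := by
    obtain ⟨r, hr⟩ : ∃ r, r = a * b * z ^ 2 / 4 := ⟨_, rfl⟩
    obtain ⟨r', hr'⟩ : ∃ r', r' = a' * b' * z' ^ 2 / 4 := ⟨_, rfl⟩
    rw [← hr, ← hr'] at h1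
    have hrabs : |r| = a * |b| * z ^ 2 / 4 := by
      rw [hr, abs_div, abs_mul, abs_mul, abs_of_pos hapos, abs_of_pos (by positivity : 0 < z ^ 2)]
      norm_num
    have hDr : D ≤ 4 * |r| := by
      rw [hrabs, hD, ← sq_abs b]
      have : |b| ^ 2 ≤ |b| := by nlinarith
      have := mul_le_mul_of_nonneg_left this (by positivity : 0 ≤ a * z ^ 2)
      linarith
    have hsum : |r + r'| ≤ 3 * |r| := by
      have e0 : r + r' = 2 * r - (r - r') := by ring
      rw [e0]
      have := abs_sub (2 * r) (r - r')
      rw [abs_mul, abs_of_pos (by norm_num : (0:ℝ) < 2)] at this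
      linarith
    have e1 : (a * z ^ 2 / 4 - a' * z' ^ 2 / 4) * M' =
        (r + r') * (r - r') - (a * z ^ 2 / 4) * (D / 4 - M') := by
      rw [hr, hr', hM', hD]; ring
    have e2 : |a * z ^ 2 / 4 - a' * z' ^ 2 / 4| * M' ≤ (a * z ^ 2) * η := by
      rw [← abs_of_pos hM'pos, ← abs_mul, e1]
      have t := abs_sub ((r + r') * (r - r')) ((a * z ^ 2 / 4) * (D / 4 - M'))
      rw [abs_mul, abs_mul, abs_of_pos (by positivity : 0 < a * z ^ 2 / 4)] at t
      have t1 := mul_le_mul hsum h1 (abs_nonneg _) (by positivity)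
      have t2 := mul_le_mul_of_nonneg_left h2 (by positivity : 0 ≤ a * z ^ 2 / 4)
      have t3 : |r| ≤ a * z ^ 2 / 4 := by
        rw [hrabs]
        have := mul_le_mul_of_nonneg_left hb (by positivity : 0 ≤ a * z ^ 2)
        linarith
      have t4 := mul_le_mul_of_nonneg_right t3 hη0
      linarith
    have e3 := mul_le_mul_of_nonneg_left hM'low (abs_nonneg (a * z ^ 2 / 4 - a' * z' ^ 2 / 4))
    have e4 : |a * z ^ 2 / 4 - a' * z' ^ 2 / 4| * D ≤ (5 * e * a * z ^ 3) * D := by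
      have : (5 * e * a * z ^ 3) * D = 5 * ((a * z ^ 2) * η) := by rw [hηD]; ring
      rw [this]; linarith
    exact le_of_mul_le_mul_right e4 hDpos
  have haz : a * z ≤ 2 := by nlinarith
  -- z squared
  have hzz : |z ^ 2 - z' ^ 2| ≤ 85 * e * z ^ 2 := by
    have e1 : z ^ 2 - z' ^ 2 = 4 * (a * z ^ 2 / 4 - a' * z' ^ 2 / 4)
        + (x * z + x' * z') * (x * z - x' * z') := by rw [ha, ha']; ring
    have hs : |x * z + x' * z'| ≤ 3 * z := by
      have e0 : x * z + x' * z' = 2 * (x * z) - (x * z - x' * z') := by ring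
      rw [e0]
      have := abs_sub (2 * (x * z)) (x * z - x' * z')
      rw [abs_mul, abs_mul, abs_of_pos hz, abs_of_pos (by norm_num : (0:ℝ) < 2)] at this
      nlinarith
    rw [e1]
    have t := abs_add_le (4 * (a * z ^ 2 / 4 - a' * z' ^ 2 / 4))
      ((x * z + x' * z') * (x * z - x' * z'))
    rw [abs_mul, abs_mul, abs_of_pos (by norm_num : (0:ℝ) < 4)] at t
    have t1 := mul_le_mul hs hu (abs_nonneg _) (by positivity)
    have t2 := mul_le_mul_of_nonneg_left haz (by positivity : 0 ≤ e * z ^ 2)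
    have t3 : e * z ^ 2 * (a * z) = e * a * z ^ 3 := by ring
    rw [t3] at t2
    linarith
  have hzd : |z - z'| ≤ 85 * e * z := by
    have e1 : |z - z'| * (z + z') = |z ^ 2 - z' ^ 2| := by
      rw [← abs_of_pos (by positivity : 0 < z + z'), ← abs_mul]
      congr 1; ring
    have e2 : |z - z'| * z ≤ (85 * e * z) * z := by
      have t0 := mul_nonneg (abs_nonneg (z - z')) hz'.le
      linarith
    exact le_of_mul_le_mul_right e2 hz
  refine ⟨hzd, ?_⟩
  have hz'low : z / 2 ≤ z' := by
    have := (abs_le.mp hzd).2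
    nlinarith
  by_cases hxc : 1 / 2 ≤ |x|
  · have had : |x ^ 2 - x' ^ 2| ≤ 500 * e * a := by
      have e1 : (x ^ 2 - x' ^ 2) * z' ^ 2 =
          -(4 * (a * z ^ 2 / 4 - a' * z' ^ 2 / 4)) + a * (z ^ 2 - z' ^ 2) := by
        rw [ha, ha']; ring
      have e2 : |x ^ 2 - x' ^ 2| * z' ^ 2 ≤ 125 * e * a * z ^ 2 := by
        have hp : 0 < z' ^ 2 := by positivity
        rw [← abs_of_pos hp, ← abs_mul, e1]
        have t := abs_add_le (-(4 * (a * z ^ 2 / 4 - a' * z' ^ 2 / 4))) (a * (z ^ 2 - z' ^ 2))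
        rw [abs_neg, abs_mul, abs_mul, abs_of_pos (by norm_num : (0:ℝ) < 4), abs_of_pos hapos] at t
        have t1 := mul_le_mul_of_nonneg_left hzz hapos.le
        have t2 := mul_le_mul_of_nonneg_left hz2 (by positivity : 0 ≤ e * a * z ^ 2)
        have t3 : e * a * z ^ 2 * z = e * a * z ^ 3 := by ring
        rw [t3] at t2
        linarith
      have e3 : z ^ 2 / 4 ≤ z' ^ 2 := by nlinarith
      have e4 := mul_le_mul_of_nonneg_left e3 (abs_nonneg (x ^ 2 - x' ^ 2))
      have e5 : |x ^ 2 - x' ^ 2| * z ^ 2 ≤ (500 * e * a) * z ^ 2 := by linarith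
      exact le_of_mul_le_mul_right e5 (by positivity)
    have hsame : 1 / 2 ≤ |x + x'| := by
      have hul := abs_le.mp hu
      rcases le_abs.mp hxc with h | h
      · have : 0 < x' * z' := by nlinarith
        have : 0 < x' := pos_of_mul_pos_left this hz'.le
        rw [abs_of_pos (by linarith)]; linarith
      · have : 0 < (-x') * z' := by nlinarith
        have : 0 < -x' := pos_of_mul_pos_left this hz'.le
        rw [abs_of_neg (by linarith)]; linarith
    have e1 : |x - x'| * |x + x'| = |x ^ 2 - x' ^ 2| := by
      rw [← abs_mul]; congr 1; ring
    have e2 := mul_le_mul_of_nonneg_left hsame (abs_nonneg (x - x'))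
    linarith
  · have hxh : |x| < 1 / 2 := not_le.mp hxc
    have ha34 : 3 / 4 ≤ a := by
      rw [ha, ← sq_abs x]; nlinarith [abs_nonneg x]
    have e1 : (x - x') * z' = (x * z - x' * z') - x * (z - z') := by ring
    have e2 : |x - x'| * z' ≤ 100 * e * z := by
      rw [← abs_of_pos hz', ← abs_mul, e1]
      have t := abs_sub (x * z - x' * z') (x * (z - z'))
      rw [abs_mul] at t
      have := mul_le_mul hxabs hzd (abs_nonneg _) zero_le_one
      linarith
    have e3 := mul_le_mul_of_nonneg_left hz'low (abs_nonneg (x - x'))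
    have e4 : |x - x'| * z ≤ (200 * e) * z := by linarith
    have e5 := le_of_mul_le_mul_right e4 hz
    nlinarith

/-- The ranges of the scalar parameters. -/
lemma phiAll_facts {K : ℕ} {π : PP K} (h : π ∈ PhiAll K) :
    π.1.1 ^ 2 < 1 ∧ π.1.2.1 ≠ 0 ∧ |π.1.2.1| ≤ 1 ∧ 0 < π.1.2.2 ∧ π.1.2.2 ≤ 2 := by
  simp only [PhiAll, Set.mem_iUnion] at h
  obtain ⟨δ, hδ, ε, hε, ζ, hζ, θ, ⟨⟨⟨hp0, hp1⟩, ⟨hq0, hq1⟩, hf0, hf1⟩, -, -, h2, h3⟩, rfl⟩ := h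
  simp only [pack, phiOf]
  refine ⟨?_, ?_, ?_, ?_, ?_⟩
  · rw [div_pow, div_lt_one (by positivity)]
    nlinarith [mul_pos hp0 hq0]
  · exact abs_pos.mp (lt_of_lt_of_le hε.1 h2)
  · rw [abs_le]; constructor <;> linarith
  · exact lt_of_lt_of_le hζ h3
  · unfold enormF
    rw [Real.sqrt_le_left (by norm_num)]
    have hle : ∀ (f : Fin K → ℝ), IsDensity f → ∀ k, f k ≤ 1 := by
      intro f hf k
      rw [← hf.2]
      exact Finset.single_le_sum (fun i _ => hf.1 i) (Finset.mem_univ k)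
    calc ∑ a, (θ.f0 a - θ.f1 a) ^ 2 ≤ ∑ a, (θ.f0 a + θ.f1 a) := by
          apply Finset.sum_le_sum
          intro k _
          have a1 := hf0.1 k
          have a2 := hf1.1 k
          have a3 := hle _ hf0 k
          have a4 := hle _ hf1 k
          nlinarith [mul_nonneg a1 a2]
      _ = 2 := by rw [Finset.sum_add_distrib, hf0.2, hf1.2]; norm_num
      _ ≤ 2 ^ 2 := by norm_num

lemma sgn_sq (t : ℝ) : sgn t ^ 2 = 1 := by
  unfold sgn; split_ifs <;> norm_num

/-- Parts (i) and (iii) combined. -/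
lemma parts_main {K : ℕ} {η : ℝ} (hη : 0 ≤ η) {π π' : PP K} (h : π ∈ PhiAll K)
    (h' : π' ∈ PhiAll K)
    (hlt : η < 1 / 1000 * (1 - π.1.1 ^ 2) * π.1.2.1 ^ 2 * π.1.2.2 ^ 3)
    (hρ : rho π π' ≤ η) :
    |π.1.1 - sgn (∑ k, π.2.2 k * π'.2.2 k) * π'.1.1|
        ≤ 1000 * η / (π.1.2.1 ^ 2 * π.1.2.2 ^ 3) ∧
      |π.1.2.2 - π'.1.2.2|
        ≤ 1000 * η / ((1 - π.1.1 ^ 2) * π.1.2.1 ^ 2 * π.1.2.2 ^ 2) := by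
  obtain ⟨hx, hb0, hb1, hz, hz2⟩ := phiAll_facts h
  obtain ⟨hx', hb0', hb1', hz', hz2'⟩ := phiAll_facts h'
  simp only [rho, max_le_iff, mvec, rfun] at hρ
  obtain ⟨⟨⟨⟨h1, h2⟩, h3⟩, -⟩, -⟩ := hρ
  obtain ⟨⟨x, b, z⟩, ψ⟩ := π
  obtain ⟨⟨x', b', z'⟩, ψ'⟩ := π'
  simp only at *
  generalize hs : sgn (∑ k, ψ.2 k * ψ'.2 k) = s at *
  have hs2 : s ^ 2 = 1 := by rw [← hs]; exact sgn_sq _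
  have ha : 0 < 1 - x ^ 2 := by linarith
  have hb2 : 0 < b ^ 2 := by positivity
  have hden : 0 < (1 - x ^ 2) * b ^ 2 * z ^ 3 := by positivity
  obtain ⟨e, he⟩ : ∃ e, e = η / ((1 - x ^ 2) * b ^ 2 * z ^ 3) := ⟨_, rfl⟩
  have heq : η = e * (1 - x ^ 2) * b ^ 2 * z ^ 3 := by
    rw [he]; field_simp
  have he0 : 0 ≤ e := by rw [he]; positivity
  have hec : e < 1 / 1000 := by
    rw [he, div_lt_iff₀ hden]; linarith
  have hsx : (s * x') ^ 2 = x' ^ 2 := by rw [mul_pow, hs2, one_mul]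
  have key := core_main x b z (s * x') b' z' e hx hb0 hb1 hz hz2 hz' (by rw [hsx]; exact hx') hb0'
    he0 hec (by rw [hsx, ← heq]; exact h1) (by rw [hsx, ← heq]; exact h2)
    (by
      rw [hsx, ← heq]
      have : s * x' * b' * z' * ((1 - x' ^ 2) * b' * z' ^ 2 / 4)
        = s * (x' * b' * z' * ((1 - x' ^ 2) * b' * z' ^ 2 / 4)) := by ring
      rw [this]; exact h3)
  refine ⟨key.2.trans (le_of_eq ?_), key.1.trans ?_⟩
  · rw [heq]; field_simp
  · have : 1000 * η / ((1 - x ^ 2) * b ^ 2 * z ^ 2) = 1000 * e * z := by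
      rw [heq]; field_simp
    rw [this]
    nlinarith [mul_nonneg he0 hz.le]

theorem statement19 (K : ℕ) (hK : 2 ≤ K) :
    ∃ c C : ℝ, 0 < c ∧ 0 < C ∧
      ∀ η : ℝ, η ∈ Set.Icc (0 : ℝ) 1 →
      ∀ π ∈ PhiAll K,
        (η < c * (1 - π.1.1 ^ 2) * π.1.2.1 ^ 2 * π.1.2.2 ^ 3 →
          ∀ π' ∈ PhiAll K, rho π π' ≤ η →
            |π.1.1 - sgn (∑ k, π.2.2 k * π'.2.2 k) * π'.1.1|
              ≤ C * η / (π.1.2.1 ^ 2 * π.1.2.2 ^ 3))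
        ∧ (η < c * (1 - π.1.1 ^ 2) * |π.1.2.1| * π.1.2.2 ^ 2 →
          ∀ π' ∈ PhiAll K, rho π π' ≤ η →
            |π.1.2.1 - π'.1.2.1|
              ≤ C * η / ((1 - π.1.1 ^ 2) * |π.1.2.1| * π.1.2.2 ^ 2))
        ∧ (η < c * (1 - π.1.1 ^ 2) * π.1.2.1 ^ 2 * π.1.2.2 ^ 3 →
          ∀ π' ∈ PhiAll K, rho π π' ≤ η →
            |π.1.2.2 - π'.1.2.2|
              ≤ C * η / ((1 - π.1.1 ^ 2) * π.1.2.1 ^ 2 * π.1.2.2 ^ 2)) := by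
  refine ⟨1 / 1000, 1000, by norm_num, by norm_num, ?_⟩
  intro η hη π hπ
  refine ⟨fun hlt π' hπ' hρ => (parts_main hη.1 hπ hπ' hlt hρ).1, ?_,
    fun hlt π' hπ' hρ => (parts_main hη.1 hπ hπ' hlt hρ).2⟩
  intro hlt π' hπ' hρ
  obtain ⟨hx, hb0, hb1, hz, hz2⟩ := phiAll_facts hπ
  simp only [rho, max_le_iff, mvec] at hρ
  obtain ⟨⟨⟨⟨h1, h2⟩, -⟩, -⟩, -⟩ := hρ
  have ha : 0 < 1 - π.1.1 ^ 2 := by linarith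
  have hbpos : 0 < |π.1.2.1| := abs_pos.mpr hb0
  have hrabs : |rfun π.1| = (1 - π.1.1 ^ 2) * |π.1.2.1| * π.1.2.2 ^ 2 / 4 := by
    rw [rfun, abs_div, abs_mul, abs_mul, abs_of_pos ha,
      abs_of_pos (by positivity : 0 < π.1.2.2 ^ 2)]
    norm_num
  have hpos : 0 < (1 - π.1.1 ^ 2) * |π.1.2.1| * π.1.2.2 ^ 2 := by positivity
  have key := core_two π.1.2.1 (rfun π.1) π'.1.2.1 (rfun π'.1) η hb1 hη.1
    (by rw [hrabs]; linarith) h1 h2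
  rw [le_div_iff₀ hpos]
  rw [hrabs] at key
  have := hη.1
  linarith

end PaperHMM
end
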